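/- Let R be a supertropical semiring, let b : {1,…,n} → {1,…,η} be a surjective nondecreasing map, and let N ∈ M_n(R) be block triangular with respect to b, with diagonal blocks N_1, …, N_η. Suppose that for each t ∈ {1,…,η} there is m_t ≥ 1 such that N_t^{m_t} is a ghost matrix. Then for every m ≥ max{m_1, …, m_η}, the matrix N^{η·m} is a ghost matrix. -/

import Mathlib

/-- A supertropical semiring structure on a commutative semiring `R`, given by the ghost
map `ν`.  The ghost ideal is `Set.range ν`; the tangible elements are those not in it. -/
structure IsSupertropical {R : Type*} [CommSemiring R] (ν : R → R) : Prop where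
  idem : ∀ a : R, ν (ν a) = ν a
  addMap : ∀ a b : R, ν (a + b) = ν a + ν b
  mulMap : ∀ a b : R, ν (a * b) = ν a * ν b
  ghost : ∀ a : R, ν a = a + a
  addEq : ∀ a b : R, ν a = ν b → a + b = ν a
  addNe : ∀ a b : R, ν a ≠ ν b → a + b = a ∨ a + b = b


/-- The `t`-th diagonal block of `N` with respect to the block structure `b`. -/
def stDiagBlock {n η : ℕ} {R : Type*} [CommSemiring R] (b : Fin n → Fin η)
    (N : Matrix (Fin n) (Fin n) R) (t : Fin η) :
    Matrix {i : Fin n // b i = t} {i : Fin n // b i = t} R :=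
  fun i j => N i.1 j.1

/-- The ghost elements form an ideal. -/
def ghostIdeal {R : Type*} [CommSemiring R] {ν : R → R} (hST : IsSupertropical ν) : Ideal R where
  carrier := Set.range ν
  zero_mem' := ⟨0, by rw [hST.ghost, add_zero]⟩
  add_mem' := by
    rintro _ _ ⟨x, rfl⟩ ⟨y, rfl⟩
    exact ⟨x + y, hST.addMap x y⟩
  smul_mem' := by
    rintro c _ ⟨x, rfl⟩
    exact ⟨c * x, by rw [hST.ghost, hST.ghost, smul_eq_mul, mul_add]⟩

section EntriesInIdeal

variable {ι R : Type*} [Fintype ι] [CommSemiring R] {I : Ideal R}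

theorem mul_apply_mem_of_left_row {X : Matrix ι ι R} (Y : Matrix ι ι R) {i : ι}
    (hX : ∀ l, X i l ∈ I) (j : ι) : (X * Y) i j ∈ I := by
  rw [Matrix.mul_apply]
  exact I.sum_mem fun l _ => I.mul_mem_right _ (hX l)

theorem mul_apply_mem_of_right (X : Matrix ι ι R) {Y : Matrix ι ι R}
    (hY : ∀ i j, Y i j ∈ I) (i j : ι) : (X * Y) i j ∈ I := by
  rw [Matrix.mul_apply]
  exact I.sum_mem fun l _ => I.mul_mem_left _ (hY l j)

end EntriesInIdeal

/-- `X` vanishes outside the entries whose block index rises by at least `r`. -/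
def RaisesBlock {ι R : Type*} [Zero R] (b : ι → ℕ) (r : ℕ) (X : Matrix ι ι R) : Prop :=
  ∀ i j, b j < b i + r → X i j = 0

section Raising

variable {ι R : Type*} [Fintype ι] [CommSemiring R] {b : ι → ℕ}

theorem RaisesBlock.mul {r s : ℕ} {X Y : Matrix ι ι R} (hX : RaisesBlock b r X)
    (hY : RaisesBlock b s Y) : RaisesBlock b (r + s) (X * Y) := by
  intro i j hij
  rw [Matrix.mul_apply]
  refine Finset.sum_eq_zero fun l _ => ?_
  by_cases h : b l < b i + r
  · rw [hX i l h, zero_mul]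
  · rw [hY l j (by omega), mul_zero]

variable [DecidableEq ι]

theorem RaisesBlock.pow {X : Matrix ι ι R} (hX : RaisesBlock b 0 X) (k : ℕ) :
    RaisesBlock b 0 (X ^ k) := by
  induction k with
  | zero =>
    intro i j hij
    rw [pow_zero, Matrix.one_apply_ne]
    rintro rfl
    omega
  | succ k ih => rw [pow_succ]; exact ih.mul hX

/-- If `D` preserves blocks, `U` strictly raises them, and `D ^ m` has entries in `I`, then
multiplying a matrix that raises blocks by `r` with `(D + U) ^ (q * m)` gives entries in `I`
as soon as `r + q` reaches the number of blocks. -/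
theorem RaisesBlock.mul_add_pow_mem {I : Ideal R} {D U : Matrix ι ι R} {η m : ℕ}
    (hb : ∀ i, b i < η) (hD : RaisesBlock b 0 D) (hU : RaisesBlock b 1 U)
    (hDm : ∀ i j, (D ^ m) i j ∈ I) (q : ℕ) :
    ∀ (r : ℕ) (X : Matrix ι ι R), RaisesBlock b r X → η ≤ r + q →
      ∀ i j, (X * (D + U) ^ (q * m)) i j ∈ I := by
  induction q with
  | zero =>
    intro r X hX hr i j
    refine mul_apply_mem_of_left_row _ (fun l => ?_) j
    rw [hX i l (by have := hb l; omega)]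
    exact I.zero_mem
  | succ q ih =>
    intro r X hX hr
    have key : ∀ k l, l + k = m → ∀ i j, (X * D ^ l * (D + U) ^ (q * m + k)) i j ∈ I := by
      intro k
      induction k with
      | zero =>
        rintro l rfl i j
        exact mul_apply_mem_of_left_row _ (mul_apply_mem_of_right X hDm i) j
      | succ k ihk =>
        intro l hl i j
        have hXU : RaisesBlock b (r + 1) (X * D ^ l * U) := (hX.mul (hD.pow l)).mul hU
        have hsplit : X * D ^ l * (D + U) ^ (q * m + (k + 1)) =
            X * D ^ (l + 1) * (D + U) ^ (q * m + k) +
              X * D ^ l * U * (D + U) ^ (q * m) * (D + U) ^ k := by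
          rw [← add_assoc, pow_succ' (D + U), pow_succ D, mul_assoc _ _ ((D + U) ^ k), ← pow_add]
          simp only [mul_assoc, mul_add, add_mul]
        rw [hsplit, Matrix.add_apply]
        exact I.add_mem (ihk (l + 1) (by omega) i j)
          (mul_apply_mem_of_left_row _ (ih (r + 1) _ hXU (by omega) i) j)
    intro i j
    simpa [Nat.succ_mul] using key m 0 (zero_add m) i j

end Raising

/-- The block diagonal part of `N`. -/
def blockDiagPart {n η : ℕ} {R : Type*} [CommSemiring R] (b : Fin n → Fin η)
    (N : Matrix (Fin n) (Fin n) R) : Matrix (Fin n) (Fin n) R :=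
  fun i j => if b j = b i then N i j else 0

theorem blockDiagPart_pow_apply {n η : ℕ} {R : Type*} [CommSemiring R] (b : Fin n → Fin η)
    (N : Matrix (Fin n) (Fin n) R) (t : Fin η) (k : ℕ) (i : {i : Fin n // b i = t}) (j : Fin n) :
    (blockDiagPart b N ^ k) i j =
      if h : b j = t then (stDiagBlock b N t ^ k) i ⟨j, h⟩ else 0 := by
  induction k generalizing i with
  | zero =>
    by_cases h : b j = t
    · simp [h, Matrix.one_apply, Subtype.ext_iff]
    · have hij : (i : Fin n) ≠ j := fun e => h (e ▸ i.2)
      simp [h, Matrix.one_apply_ne hij]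
  | succ k ih =>
    have hsum : (blockDiagPart b N ^ (k + 1)) i j =
        ∑ l : {l : Fin n // b l = t}, N i l * (blockDiagPart b N ^ k) l j := by
      rw [pow_succ', Matrix.mul_apply,
        ← Finset.sum_subtype (Finset.univ.filter fun l => b l = t) (by simp)
          (fun l => N i l * (blockDiagPart b N ^ k) l j), Finset.sum_filter]
      refine Finset.sum_congr rfl fun l _ => ?_
      simp [blockDiagPart, i.2]
    rw [hsum]
    simp only [ih]
    by_cases h : b j = t
    · simp [h, pow_succ', Matrix.mul_apply, stDiagBlock]
    · simp [h]

theorem blockDiagPart_pow_mem {n η : ℕ} {R : Type*} [CommSemiring R] {I : Ideal R}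
    (b : Fin n → Fin η) (N : Matrix (Fin n) (Fin n) R) (mt : Fin η → ℕ)
    (hI : ∀ t, ∀ i j, ((stDiagBlock b N t) ^ (mt t)) i j ∈ I)
    {m : ℕ} (hm : ∀ t, mt t ≤ m) (i j : Fin n) : (blockDiagPart b N ^ m) i j ∈ I := by
  rw [← Nat.add_sub_cancel' (hm (b i)), pow_add]
  refine mul_apply_mem_of_left_row _ (fun l => ?_) j
  rw [blockDiagPart_pow_apply b N (b i) (mt (b i)) ⟨i, rfl⟩ l]
  split_ifs
  · exact hI _ _ _
  · exact I.zero_mem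

/-- Lemma 4.9: over a supertropical semiring, if `N` is block triangular
with diagonal blocks `N_1, …, N_η`, and `N_t ^ (m_t)` is ghost for each `t`, then
`N ^ (η·m)` is ghost for every `m ≥ max_t m_t`. -/
theorem ghostpotent_block_triangular {R : Type*} [CommSemiring R] (ν : R → R)
    (hST : IsSupertropical ν) {n η : ℕ}
    (b : Fin n → Fin η) (hmono : Monotone b) (hsurj : Function.Surjective b)
    (N : Matrix (Fin n) (Fin n) R) (htri : ∀ i j : Fin n, b j < b i → N i j = 0)
    (mt : Fin η → ℕ) (hmt : ∀ t, 1 ≤ mt t)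
    (hghost : ∀ t, ∀ i j, ((stDiagBlock b N t) ^ (mt t)) i j ∈ Set.range ν)
    (m : ℕ) (hm : ∀ t, mt t ≤ m) :
    ∀ i j, (N ^ (η * m)) i j ∈ Set.range ν := by
  set U : Matrix (Fin n) (Fin n) R := fun i j => if b j = b i then 0 else N i j with hU_def
  have hN : N = blockDiagPart b N + U := by
    ext i j
    rw [Matrix.add_apply]
    by_cases h : b j = b i <;> simp [blockDiagPart, hU_def, h]
  have hD : RaisesBlock (fun i => (b i : ℕ)) 0 (blockDiagPart b N) := by
    intro i j hij
    exact if_neg fun h => by simp [h] at hij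
  have hU : RaisesBlock (fun i => (b i : ℕ)) 1 U := by
    intro i j hij
    by_cases h : b j = b i
    · exact if_pos h
    · refine (if_neg h).trans (htri i j ?_)
      exact lt_of_le_of_ne (Fin.le_def.2 (Nat.lt_succ_iff.1 hij)) h
  have hone : RaisesBlock (fun i => (b i : ℕ)) 0 (1 : Matrix (Fin n) (Fin n) R) := by
    simpa using hD.pow 0
  intro i j
  have h := hD.mul_add_pow_mem (I := ghostIdeal hST) (fun i => (b i).isLt) hU
    (blockDiagPart_pow_mem b N mt hghost hm) η 0 1 hone (Nat.zero_add η).ge i j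
  rwa [one_mul, ← hN] at h
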